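/- arXiv:2409.12821 — 3 statements merged into one kernel-verified Lean document; each statement's English description precedes it below -/
import Mathlib

section
/- For every natural number m, m(m+4)·binomial(m+3,3)^2/80 = binomial(m+4,5)^2 − binomial(m+5,5)·binomial(m+3,5). (The left-hand side is the coefficient \tilde{\delta}(m) in \Delta(Sym^m E)=\tilde{\delta}(m)\Delta(E) for rank-4 bundles E; the right-hand side is Mukai's count of standard tableaux of size (m−1,m−1) for Mat(2,6), i.e. h^0(Gr(2,6), O(m−1)).) -/
/-- `m(m+4)·binomial(m+3,3)^2/80 = binomial(m+4,5)^2 − binomial(m+5,5)·binomial(m+3,5)`: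
the discriminant coefficient `δ̃(m)` equals Mukai's count of standard tableaux of size
`(m−1,m−1)` for `Mat(2,6)`, i.e. `h^0(Gr(2,6), O(m−1))`. -/
theorem delta_tilde_eq_mukai_count (m : ℕ) :
    (m : ℚ) * ((m : ℚ) + 4) * ((Nat.choose (m + 3) 3 : ℚ)) ^ 2 / 80 =
      ((Nat.choose (m + 4) 5 : ℚ)) ^ 2 -
        (Nat.choose (m + 5) 5 : ℚ) * (Nat.choose (m + 3) 5 : ℚ) := by
  simp only [Nat.cast_choose_eq_ascPochhammer_div]
  have e1 : (((m + 4 - (5 - 1) : ℕ)) : ℚ) = m := by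
    congr 1
  have e2 : (((m + 5 - (5 - 1) : ℕ)) : ℚ) = m + 1 := by
    rw [show m + 5 - (5 - 1) = m + 1 by omega]; push_cast; ring
  have e4 : (((m + 3 - (3 - 1) : ℕ)) : ℚ) = m + 1 := by
    rw [show m + 3 - (3 - 1) = m + 1 by omega]; push_cast; ring
  rcases Nat.eq_zero_or_pos m with rfl | hm
  · norm_num [ascPochhammer_succ_right, Nat.factorial]
  have e3 : (((m + 3 - (5 - 1) : ℕ)) : ℚ) = m - 1 := by
    rw [show m + 3 - (5 - 1) = m - 1 by omega, Nat.cast_sub hm]; simp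
  rw [e1, e2, e3, e4]
  simp only [ascPochhammer_succ_right, ascPochhammer_zero, Polynomial.eval_mul,
    Polynomial.eval_add, Polynomial.eval_X, Polynomial.eval_natCast, Polynomial.eval_one,
    Nat.factorial]
  push_cast
  ring
end

section
/- For all integers m ≥ t ≥ 0, \sum_{i=0}^{t} (1/2)·( \ell(m+t−i,i,0)^2 − \delta(m+t−i,i,0)/4 )·r(m+t−i,i,0) = (1/8)·( t(t−1)/5 + mt/2 + m(m−1)/5 )·r_m·r_t. (This identity expresses that the c_1^2-coefficients of ch_2 match on both sides of the Pieri decomposition Sym^m Q ⊗ Sym^t Q = \bigoplus_{i=0}^{t} \Sigma_{(m+t−i,i,0,0)} Q.) -/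
/-- `r(m,t,s)`: the rank of `Σ_{(m,t,s,0)}` applied to a rank-4 bundle
(Weyl dimension formula). -/
def rP (m t s : ℚ) : ℚ :=
  (m + 3) * (t + 2) * (s + 1) * (m - t + 1) * (m - s + 2) * (t - s + 1) / 12

/-- `ℓ(m,t,s) = (m+t+s)/4`. -/
def lP (m t s : ℚ) : ℚ := (m + t + s) / 4

/-- `τ(m,t,s) = (−2(mt+ms+ts)+3m+t−s)/3`. -/
def tauP (m t s : ℚ) : ℚ := (-2 * (m * t + m * s + t * s) + 3 * m + t - s) / 3

/-- `δ(m,t,s) = (4ℓ(m,t,s)^2 + τ(m,t,s))/5`. -/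
def deltaP (m t s : ℚ) : ℚ := (4 * (lP m t s) ^ 2 + tauP m t s) / 5

/-- `α(t,s)`. -/
def alphaP (t s : ℚ) : ℚ := 9 * t ^ 2 + 21 * t * s + 9 * s ^ 2 - 33 * t - 30 * s + 21

/-- `β(t,s)`. -/
def betaP (t s : ℚ) : ℚ :=
  21 * t ^ 2 * s + 21 * t * s ^ 2 - 15 * t ^ 2 - 18 * t * s + 6 * s ^ 2 + t - 8 * s - 6

/-- `γ(t,s)`. -/
def gammaP (t s : ℚ) : ℚ :=
  9 * t ^ 2 * s ^ 2 - 9 * t ^ 2 * s + 9 * t * s ^ 2 - 3 * t ^ 2 + 13 * t * s - 3 * s ^ 2 -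
    14 * t + 14 * s

/-- `ξ(m,t,s) = (α(t,s)m^2 + β(t,s)m + γ(t,s))/60`. -/
def xiP (m t s : ℚ) : ℚ := (alphaP t s * m ^ 2 + betaP t s * m + gammaP t s) / 60

/-- The identity with `N = m + t` fixed, so that the summand does not depend on `t`. -/
theorem pieri_aux (N : ℚ) (n : ℕ) :
    ∑ i ∈ Finset.range (n + 1),
        (1 / 2 : ℚ) *
          ((lP (N - (i : ℚ)) (i : ℚ) 0) ^ 2 - deltaP (N - (i : ℚ)) (i : ℚ) 0 / 4) *
          rP (N - (i : ℚ)) (i : ℚ) 0 =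
      (1 / 8 : ℚ) *
          ((n : ℚ) * ((n : ℚ) - 1) / 5 + (N - n) * (n : ℚ) / 2 +
            (N - n) * ((N - n) - 1) / 5) *
          rP (N - n) 0 0 * rP (n : ℚ) 0 0 := by
  induction n with
  | zero =>
    simp [lP, deltaP, tauP, rP]
    ring
  | succ k ih =>
    rw [Finset.sum_range_succ, ih]
    simp only [lP, deltaP, tauP, rP]
    push_cast
    ring

/-- Pieri identity for the `c₁²`-coefficient of `ch₂` in
`Sym^m Q ⊗ Sym^t Q = ⨁_{i=0}^t Σ_{(m+t−i,i,0,0)} Q`. -/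
theorem ch2_c1sq_pieri_sym (m t : ℤ) (ht : 0 ≤ t) (htm : t ≤ m) :
    ∑ i ∈ Finset.Icc (0 : ℤ) t,
        (1 / 2 : ℚ) *
          ((lP ((m : ℚ) + (t : ℚ) - (i : ℚ)) (i : ℚ) 0) ^ 2 -
            deltaP ((m : ℚ) + (t : ℚ) - (i : ℚ)) (i : ℚ) 0 / 4) *
          rP ((m : ℚ) + (t : ℚ) - (i : ℚ)) (i : ℚ) 0 =
      (1 / 8 : ℚ) *
          ((t : ℚ) * ((t : ℚ) - 1) / 5 + (m : ℚ) * (t : ℚ) / 2 +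
            (m : ℚ) * ((m : ℚ) - 1) / 5) *
          rP (m : ℚ) 0 0 * rP (t : ℚ) 0 0 := by
  obtain ⟨n, rfl⟩ := Int.eq_ofNat_of_zero_le ht
  have h := pieri_aux ((m : ℚ) + ((n : ℤ) : ℚ)) n
  have hI : Finset.Icc (0 : ℤ) (n : ℤ) =
      (Finset.range (n + 1)).map ⟨fun k : ℕ => (k : ℤ), Nat.cast_injective⟩ := by
    ext x
    simp only [Finset.mem_Icc, Finset.mem_map, Finset.mem_range, Function.Embedding.coeFn_mk]
    constructor
    · intro hx
      exact ⟨x.toNat, by omega, by omega⟩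
    · rintro ⟨k, hk, rfl⟩
      omega
  rw [hI, Finset.sum_map]
  simp only [Function.Embedding.coeFn_mk, Int.cast_natCast, add_sub_cancel_right] at h ⊢
  exact h
end

section
/- For all integers m ≥ t ≥ 0, \sum_{i=0}^{t} \xi(m+t−i,i,0)·r(m+t−i,i,0) = ( 5m(7m−2) + 5t(7t−2) + 3mt(3mt−13m−13t+23) )/100 · r_m·r_t. (This identity expresses that the ch_4(Q)-coefficients match on both sides of the Pieri decomposition Sym^m Q ⊗ Sym^t Q = \bigoplus_{i=0}^{t} \Sigma_{(m+t−i,i,0,0)} Q.) -/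
/-- Closed form of the partial sums, as a function of `M = m + t` and the upper limit `n`. -/
def pieriG (M n : ℚ) : ℚ :=
  (((36) * n ^ 2 + (275) * n ^ 4 + (-427) * n ^ 6 + (125) * n ^ 8 + (-9) * n ^ 10) * M ^ 0 +
      ((-360) * n ^ 0 + (-36) * n ^ 1 + (1960) * n ^ 2 + (-550) * n ^ 3 + (-1505) * n ^ 4 + (1281) * n ^ 5 + (130) * n ^ 6 + (-500) * n ^ 7 + (15) * n ^ 8 + (45) * n ^ 9) * M ^ 1 +
      ((600) * n ^ 0 + (-1960) * n ^ 1 + (1650) * n ^ 2 + (3010) * n ^ 3 + (-2410) * n ^ 4 + (-390) * n ^ 5 + (850) * n ^ 6 + (-60) * n ^ 7 + (-90) * n ^ 8) * M ^ 2 +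
      ((1950) * n ^ 0 + (-1375) * n ^ 1 + (-1665) * n ^ 2 + (2685) * n ^ 3 + (225) * n ^ 4 + (-800) * n ^ 5 + (90) * n ^ 6 + (90) * n ^ 7) * M ^ 3 +
      ((1200) * n ^ 0 + (160) * n ^ 1 + (-1280) * n ^ 2 + (200) * n ^ 3 + (425) * n ^ 4 + (-60) * n ^ 5 + (-45) * n ^ 6) * M ^ 4 +
      ((210) * n ^ 0 + (151) * n ^ 1 + (-165) * n ^ 2 + (-100) * n ^ 3 + (15) * n ^ 4 + (9) * n ^ 5) * M ^ 5) / 3600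

theorem pieri_partial (M : ℚ) (n : ℕ) :
    ∑ i ∈ Finset.range (n + 1), xiP (M - (i : ℚ)) (i : ℚ) 0 * rP (M - (i : ℚ)) (i : ℚ) 0 =
      pieriG M n := by
  induction n with
  | zero =>
    simp [pieriG, xiP, rP, alphaP, betaP, gammaP]
    ring
  | succ k ih =>
    rw [Finset.sum_range_succ, ih]
    simp only [pieriG, xiP, rP, alphaP, betaP, gammaP]
    push_cast
    ring

theorem pieri_sum_Icc (f : ℚ → ℚ) (n : ℕ) :
    ∑ i ∈ Finset.Icc (0 : ℤ) (n : ℤ), f (i : ℚ) =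
      ∑ i ∈ Finset.range (n + 1), f (i : ℚ) := by
  symm
  refine Finset.sum_bij (fun i _ => (i : ℤ)) ?_ ?_ ?_ ?_
  · intro i hi
    simp only [Finset.mem_range] at hi
    simp only [Finset.mem_Icc]
    omega
  · intro a _ b _ h
    exact_mod_cast h
  · intro b hb
    simp only [Finset.mem_Icc] at hb
    refine ⟨b.toNat, ?_, ?_⟩
    · simp only [Finset.mem_range]
      omega
    · exact Int.toNat_of_nonneg hb.1
  · intro i _
    simp

/-- Pieri identity for the `ch₄(Q)`-coefficient in
`Sym^m Q ⊗ Sym^t Q = ⨁_{i=0}^t Σ_{(m+t−i,i,0,0)} Q`. -/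
theorem ch4_pieri_sym (m t : ℤ) (ht : 0 ≤ t) (htm : t ≤ m) :
    ∑ i ∈ Finset.Icc (0 : ℤ) t,
        xiP ((m : ℚ) + (t : ℚ) - (i : ℚ)) (i : ℚ) 0 *
          rP ((m : ℚ) + (t : ℚ) - (i : ℚ)) (i : ℚ) 0 =
      (5 * (m : ℚ) * (7 * (m : ℚ) - 2) + 5 * (t : ℚ) * (7 * (t : ℚ) - 2) +
          3 * (m : ℚ) * (t : ℚ) *
            (3 * (m : ℚ) * (t : ℚ) - 13 * (m : ℚ) - 13 * (t : ℚ) + 23)) / 100 *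
        rP (m : ℚ) 0 0 * rP (t : ℚ) 0 0 := by
  lift t to ℕ using ht with n
  rw [pieri_sum_Icc (fun x => xiP ((m : ℚ) + ((n : ℤ) : ℚ) - x) x 0 *
    rP ((m : ℚ) + ((n : ℤ) : ℚ) - x) x 0) n, pieri_partial]
  simp only [pieriG, rP]
  push_cast
  ring
end
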